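/- Consider the Boolean cube {0,1}ⁿ. For every d ∈ {0,…,n} and every E ⊆ {0,…,n}, the degree-d h-closure of the symmetric set E̲ equals its degree-d Z-closure, and both equal the weight-determined set corresponding to L̄_{n,d}(E); that is, h-cl_{n,d}(E̲) = Z-cl_{n,d}(E̲) = {x ∈ {0,1}ⁿ : wt(x) ∈ L̄_{n,d}(E)}. -/

import Mathlib

open MvPolynomial

noncomputable section

namespace CoveringSymmetric

/-- `N = ∑ᵢ (kᵢ - 1)` for the uniform grid `[0,k₁-1] × ⋯ × [0,kₙ-1]`. -/
def Ntot (n : ℕ) (k : Fin n → ℕ) : ℕ := ∑ i, (k i - 1)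

/-- The integer points of the uniform grid `G = [0,k₁-1] × ⋯ × [0,kₙ-1]`. -/
def gridSet (n : ℕ) (k : Fin n → ℕ) : Set (Fin n → ℕ) := {x | ∀ i, x i < k i}

/-- The real point of `ℝⁿ` corresponding to an integer point. -/
def toR {n : ℕ} (x : Fin n → ℕ) : Fin n → ℝ := fun i => (x i : ℝ)

/-- The weight `wt(x) = ∑ᵢ xᵢ` of a point. -/
def wt {n : ℕ} (x : Fin n → ℕ) : ℕ := ∑ i, x i

/-- The weight-determined set `E̲ = {x ∈ G : wt(x) ∈ E}`. -/
def wdSet (n : ℕ) (k : Fin n → ℕ) (E : Finset ℕ) : Set (Fin n → ℕ) :=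
  {x ∈ gridSet n k | wt x ∈ E}

/-- The layer `j̲ = {x ∈ G : wt(x) = j}`. -/
def layer (n : ℕ) (k : Fin n → ℕ) (j : ℕ) : Set (Fin n → ℕ) :=
  {x ∈ gridSet n k | wt x = j}

/-- The grid is strictly unimodal (SU²):
`|0̲| < ⋯ < |⌊N/2⌋̲| = |⌈N/2⌉̲| > ⋯ > |N̲|`. -/
def SU2 (n : ℕ) (k : Fin n → ℕ) : Prop :=
  (∀ j, j < Ntot n k / 2 → (layer n k j).ncard < (layer n k (j + 1)).ncard) ∧
  (layer n k (Ntot n k / 2)).ncard = (layer n k ((Ntot n k + 1) / 2)).ncard ∧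
  (∀ j, (Ntot n k + 1) / 2 ≤ j → j < Ntot n k →
    (layer n k (j + 1)).ncard < (layer n k j).ncard)

/-- The zero set `Z_G(P)` of a polynomial within the grid. -/
def ZG (n : ℕ) (k : Fin n → ℕ) (P : MvPolynomial (Fin n) ℝ) : Set (Fin n → ℕ) :=
  {x ∈ gridSet n k | eval (toR x) P = 0}

/-- The degree-`d` Zariski closure of `S ⊆ G` within the grid. -/
def Zcl (n : ℕ) (k : Fin n → ℕ) (d : ℕ) (S : Set (Fin n → ℕ)) : Set (Fin n → ℕ) :=
  {a ∈ gridSet n k | ∀ P : MvPolynomial (Fin n) ℝ, P.totalDegree ≤ d →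
    (∀ x ∈ S, eval (toR x) P = 0) → eval (toR a) P = 0}

/-- The degree-`d` Z*-closure of a weight-determined set, as a set of weights:
`{j ∈ [0,N] : j̲ ⊆ Z-cl_{G,d}(E̲)}`. -/
def Zstar (n : ℕ) (k : Fin n → ℕ) (d : ℕ) (E : Finset ℕ) : Set ℕ :=
  {j | j ≤ Ntot n k ∧ layer n k j ⊆ Zcl n k d (wdSet n k E)}

/-- `PC_G(E)`: minimum total degree of a nontrivial polynomial cover of `E̲`. -/
def PC (n : ℕ) (k : Fin n → ℕ) (E : Finset ℕ) : ℕ :=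
  sInf {d | ∃ P : MvPolynomial (Fin n) ℝ, P.totalDegree = d ∧
    wdSet n k E ⊆ ZG n k P ∧ ZG n k P ≠ gridSet n k}

/-- `PPC_G(E)`: minimum total degree of a proper polynomial cover of `E̲`. -/
def PPC (n : ℕ) (k : Fin n → ℕ) (E : Finset ℕ) : ℕ :=
  sInf {d | ∃ P : MvPolynomial (Fin n) ℝ, P.totalDegree = d ∧
    wdSet n k E ⊆ ZG n k P ∧
    ∀ j ≤ Ntot n k, j ∉ E → ¬ (layer n k j ⊆ ZG n k P)}

/-- `EPC_G(E)`: minimum total degree of an exact polynomial cover of `E̲`. -/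
def EPC (n : ℕ) (k : Fin n → ℕ) (E : Finset ℕ) : ℕ :=
  sInf {d | ∃ P : MvPolynomial (Fin n) ℝ, P.totalDegree = d ∧ ZG n k P = wdSet n k E}

/-- `x` lies on the affine hyperplane `{y ∈ ℝⁿ : ∑ᵢ wᵢ yᵢ = c}` (with `w ≠ 0`). -/
def onHyp {n : ℕ} (w : Fin n → ℝ) (c : ℝ) (x : Fin n → ℕ) : Prop :=
  ∑ i, w i * (x i : ℝ) = c

/-- `HC_G(E)`: minimum size of a nontrivial hyperplane cover of `E̲`. -/
def HC (n : ℕ) (k : Fin n → ℕ) (E : Finset ℕ) : ℕ :=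
  sInf {m | ∃ (w : Fin m → Fin n → ℝ) (c : Fin m → ℝ), (∀ t, w t ≠ 0) ∧
    (∀ x ∈ wdSet n k E, ∃ t, onHyp (w t) (c t) x) ∧
    ∃ x ∈ gridSet n k, ∀ t, ¬ onHyp (w t) (c t) x}

/-- `PHC_G(E)`: minimum size of a proper hyperplane cover of `E̲`. -/
def PHC (n : ℕ) (k : Fin n → ℕ) (E : Finset ℕ) : ℕ :=
  sInf {m | ∃ (w : Fin m → Fin n → ℝ) (c : Fin m → ℝ), (∀ t, w t ≠ 0) ∧
    (∀ x ∈ wdSet n k E, ∃ t, onHyp (w t) (c t) x) ∧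
    ∀ j ≤ Ntot n k, j ∉ E → ¬ (layer n k j ⊆ {x | ∃ t, onHyp (w t) (c t) x})}

/-- The certifying degree of `S ⊆ G`: least `d ∈ [0,N]` such that some polynomial of
total degree at most `d` is nonconstant on `G` but constant on `S`. -/
def certDeg (n : ℕ) (k : Fin n → ℕ) (S : Set (Fin n → ℕ)) : ℕ :=
  sInf {d | d ≤ Ntot n k ∧ ∃ f : MvPolynomial (Fin n) ℝ, f.totalDegree ≤ d ∧
    (∃ a ∈ gridSet n k, ∃ b ∈ gridSet n k, eval (toR a) f ≠ eval (toR b) f) ∧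
    ∀ a ∈ S, ∀ b ∈ S, eval (toR a) f = eval (toR b) f}

/-- `T_{N,i} = [0,i-1] ∪ [N-i+1,N]` (so `T_{N,0} = ∅`). -/
def T (N i : ℕ) : Finset ℕ := Finset.range i ∪ Finset.Icc (N - i + 1) N

/-- `E` is `(d,i)`-admitting: `E ∪ T_{N,i} ≠ [0,N]` and `|E \ T_{N,i}| ≤ d - i`. -/
def Admitting (N d i : ℕ) (E : Finset ℕ) : Prop :=
  E ∪ T N i ≠ Finset.range (N + 1) ∧ (E \ T N i).card ≤ d - i

/-- `E` is `d`-admitting: `(d,i)`-admitting for some `i ∈ [0,d]`. -/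
def DAdmitting (N d : ℕ) (E : Finset ℕ) : Prop :=
  ∃ i ≤ d, Admitting N d i E

/-- The operator `L_{N,d}`: if `E = {t₁ < ⋯ < t_s}` with `s ≥ d+1`, then
`L_{N,d}(E) = [0, t_{s-d}] ∪ E ∪ [t_{d+1}, N]`, and `L_{N,d}(E) = E` if `s ≤ d`.
(For `E ⊆ [0,N]`, `j ≤ t_{s-d}` iff `E` has at least `d+1` elements `≥ j`, and
`t_{d+1} ≤ j` iff `E` has at least `d+1` elements `≤ j`.) -/
def Lop (N d : ℕ) (E : Finset ℕ) : Finset ℕ :=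
  E ∪ (Finset.range (N + 1)).filter fun j =>
    d + 1 ≤ (E.filter fun t => j ≤ t).card ∨ d + 1 ≤ (E.filter fun t => t ≤ j).card

/-- `L̄_{N,d}(E) = ⋃ₘ L_{N,d}^m(E)`, the union of all iterates of `L_{N,d}` on `E`. -/
def Lbar (N d : ℕ) (E : Finset ℕ) : Set ℕ :=
  ⋃ m : ℕ, ((Lop N d)^[m] E : Set ℕ)

/-- `P` is a (possibly empty) product of polynomials of total degree at most 1. -/
def ProdLinear (n : ℕ) (P : MvPolynomial (Fin n) ℝ) : Prop :=
  ∃ (m : ℕ) (ℓ : Fin m → MvPolynomial (Fin n) ℝ),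
    (∀ t, (ℓ t).totalDegree ≤ 1) ∧ P = ∏ t, ℓ t

/-- The degree-`d` h-closure of `S ⊆ G`. -/
def hcl (n : ℕ) (k : Fin n → ℕ) (d : ℕ) (S : Set (Fin n → ℕ)) : Set (Fin n → ℕ) :=
  {a ∈ gridSet n k | ∀ P : MvPolynomial (Fin n) ℝ, ProdLinear n P → P.totalDegree ≤ d →
    (∀ x ∈ S, eval (toR x) P = 0) → eval (toR a) P = 0}

/-- The `0/1` vector with support `B`. -/
def indicatorVec {n : ℕ} (B : Finset (Fin n)) : Fin n → ℕ := fun i => if i ∈ B then 1 else 0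

lemma indicatorVec_mem_gridSet {n : ℕ} (B : Finset (Fin n)) :
    indicatorVec B ∈ gridSet n (fun _ => 2) := by
  intro i
  unfold indicatorVec
  split_ifs <;> norm_num

lemma wt_indicatorVec {n : ℕ} (B : Finset (Fin n)) : wt (indicatorVec B) = B.card := by
  simp [wt, indicatorVec]

lemma exists_eq_indicatorVec {n : ℕ} {x : Fin n → ℕ} (hx : x ∈ gridSet n (fun _ => 2)) :
    ∃ B : Finset (Fin n), x = indicatorVec B := by
  refine ⟨Finset.univ.filter fun i => x i = 1, funext fun i => ?_⟩
  have h : x i < 2 := hx i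
  by_cases h1 : x i = 1
  · simp [indicatorVec, h1]
  · simp only [indicatorVec, Finset.mem_filter, Finset.mem_univ, true_and, if_neg h1]
    omega

lemma eval_indicatorVec {n : ℕ} (P : MvPolynomial (Fin n) ℝ) (B : Finset (Fin n)) :
    eval (toR (indicatorVec B)) P
      = ∑ m ∈ P.support, P.coeff m * if m.support ⊆ B then 1 else 0 := by
  rw [eval_eq]
  refine Finset.sum_congr rfl fun m _ => ?_
  congr 1
  split_ifs with h
  · exact Finset.prod_eq_one fun i hi => by simp [toR, indicatorVec, h hi]
  · obtain ⟨i, hi, hiB⟩ := Finset.not_subset.mp h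
    refine Finset.prod_eq_zero hi ?_
    simp only [toR, indicatorVec, if_neg hiB, Nat.cast_zero]
    exact zero_pow (Finsupp.mem_support_iff.mp hi)

/-- The sets of size `w` in the interval `[A, B]` of the subset lattice. -/
def slice {α : Type*} [DecidableEq α] (A B : Finset α) (w : ℕ) : Finset (Finset α) :=
  (Finset.Icc A B).filter fun C => C.card = w

lemma card_slice {α : Type*} [DecidableEq α] {A B : Finset α} (h : A ⊆ B) (k : ℕ) :
    (slice A B (A.card + k)).card = (B.card - A.card).choose k := by
  rw [← Finset.card_sdiff_of_subset h, ← Finset.card_powersetCard]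
  refine Finset.card_bij' (fun C _ => C \ A) (fun D _ => A ∪ D) ?_ ?_ ?_ ?_
  · intro C hC
    simp only [slice, Finset.mem_filter, Finset.mem_Icc] at hC
    rw [Finset.mem_powersetCard, Finset.card_sdiff_of_subset hC.1.1]
    exact ⟨Finset.sdiff_subset_sdiff hC.1.2 le_rfl, by omega⟩
  · intro D hD
    rw [Finset.mem_powersetCard, Finset.subset_sdiff] at hD
    simp only [slice, Finset.mem_filter, Finset.mem_Icc]
    exact ⟨⟨Finset.subset_union_left, Finset.union_subset h hD.1.1⟩, by
      rw [Finset.card_union_of_disjoint hD.1.2.symm, hD.2]⟩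
  · intro C hC
    simp only [slice, Finset.mem_filter, Finset.mem_Icc] at hC
    exact Finset.union_sdiff_of_subset hC.1.1
  · intro D hD
    rw [Finset.mem_powersetCard, Finset.subset_sdiff] at hD
    exact Finset.union_sdiff_cancel_left hD.1.2.symm

lemma card_slice_filter_superset {α : Type*} [DecidableEq α] {A B S : Finset α}
    (h : A ⊆ B) (hS : S ⊆ B) (k : ℕ) :
    ((slice A B (A.card + k)).filter fun C => S ⊆ C).card * (B.card - A.card).choose (S \ A).card
      = (B.card - A.card).choose k * k.choose (S \ A).card := by
  have hcard : (A ∪ S).card = A.card + (S \ A).card := by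
    rw [← Finset.union_sdiff_self_eq_union, Finset.card_union_of_disjoint Finset.disjoint_sdiff]
  have heq : ((slice A B (A.card + k)).filter fun C => S ⊆ C)
      = slice (A ∪ S) B (A.card + k) := by
    ext C
    simp only [slice, Finset.mem_filter, Finset.mem_Icc,
      Finset.union_subset_iff]
    tauto
  rw [heq]
  rcases le_or_gt (S \ A).card k with hk | hk
  · obtain ⟨l, rfl⟩ := Nat.exists_eq_add_of_le hk
    rw [← add_assoc, ← hcard, card_slice (Finset.union_subset h hS), hcard, Nat.choose_mul hk,
      Nat.sub_add_eq, Nat.add_sub_cancel_left, mul_comm]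
  · rw [Nat.choose_eq_zero_of_lt hk, mul_zero]
    have : slice (A ∪ S) B (A.card + k) = ∅ := by
      refine Finset.filter_eq_empty_iff.mpr fun C hC hc => ?_
      have := Finset.card_le_card (Finset.mem_Icc.mp hC).1
      omega
    rw [this, Finset.card_empty, zero_mul]

lemma exists_polynomial_eval_eq_choose (r : ℕ) :
    ∃ q : Polynomial ℝ, q.natDegree ≤ r ∧ ∀ k : ℕ, q.eval (k : ℝ) = k.choose r := by
  refine ⟨Polynomial.C ((r.factorial : ℝ)⁻¹) * descPochhammer ℝ r, ?_, fun k => ?_⟩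
  · exact (Polynomial.natDegree_C_mul_le _ _).trans (descPochhammer_natDegree ℝ r).le
  · have : (r.factorial : ℝ) ≠ 0 := by exact_mod_cast r.factorial_ne_zero
    rw [Polynomial.eval_mul, Polynomial.eval_C, descPochhammer_eval_eq_descFactorial,
      Nat.descFactorial_eq_factorial_mul_choose, Nat.cast_mul, inv_mul_cancel_left₀ this]

lemma exists_polynomial_card_slice {α : Type*} [DecidableEq α] {A B : Finset α} (h : A ⊆ B)
    (S : Finset α) :
    ∃ q : Polynomial ℝ, q.natDegree ≤ S.card ∧ ∀ k : ℕ,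
      (((slice A B (A.card + k)).filter fun C => S ⊆ C).card : ℝ)
        = (B.card - A.card).choose k * q.eval (k : ℝ) := by
  by_cases hS : S ⊆ B
  · obtain ⟨q, hq, hqe⟩ := exists_polynomial_eval_eq_choose (S \ A).card
    have hpos : ((B.card - A.card).choose (S \ A).card : ℝ) ≠ 0 := by
      have : (S \ A).card ≤ B.card - A.card := by
        rw [← Finset.card_sdiff_of_subset h]
        exact Finset.card_le_card (Finset.sdiff_subset_sdiff hS le_rfl)
      exact_mod_cast (Nat.choose_pos this).ne'
    refine ⟨Polynomial.C ((B.card - A.card).choose (S \ A).card : ℝ)⁻¹ * q, ?_, fun k => ?_⟩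
    · exact (Polynomial.natDegree_C_mul_le _ _).trans
        (hq.trans (Finset.card_le_card Finset.sdiff_subset))
    · have := card_slice_filter_superset h hS k
      rw [Polynomial.eval_mul, Polynomial.eval_C, hqe]
      field_simp
      exact_mod_cast this
  · refine ⟨0, by simp, fun k => ?_⟩
    have : ((slice A B (A.card + k)).filter fun C => S ⊆ C) = ∅ := by
      refine Finset.filter_eq_empty_iff.mpr fun C hC hSC => hS (hSC.trans ?_)
      exact (Finset.mem_Icc.mp (Finset.mem_filter.mp hC).1).2
    simp [this]

/-- The sums of a polynomial over the slices of an interval of the cube are, up to the size of the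
slice, given by a univariate polynomial of no larger degree. -/
lemma exists_polynomial_sum_slice {n : ℕ} {A B : Finset (Fin n)} (h : A ⊆ B)
    (P : MvPolynomial (Fin n) ℝ) :
    ∃ q : Polynomial ℝ, q.natDegree ≤ P.totalDegree ∧ ∀ k : ℕ,
      ∑ C ∈ slice A B (A.card + k), eval (toR (indicatorVec C)) P
        = (B.card - A.card).choose k * q.eval (k : ℝ) := by
  choose q hq hqe using fun S : Finset (Fin n) => exists_polynomial_card_slice h S
  refine ⟨∑ m ∈ P.support, Polynomial.C (P.coeff m) * q m.support, ?_, fun k => ?_⟩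
  · refine Polynomial.natDegree_sum_le_of_forall_le _ _ fun m hm => ?_
    refine (Polynomial.natDegree_C_mul_le _ _).trans ((hq _).trans ?_)
    refine le_trans ?_ (le_totalDegree hm)
    rw [Finset.card_eq_sum_ones, Finsupp.sum]
    exact Finset.sum_le_sum fun i hi => Nat.one_le_iff_ne_zero.mpr (Finsupp.mem_support_iff.mp hi)
  · simp_rw [eval_indicatorVec]
    rw [Finset.sum_comm, Polynomial.eval_finsetSum, Finset.mul_sum]
    refine Finset.sum_congr rfl fun m _ => ?_
    rw [← Finset.mul_sum, Finset.sum_boole, hqe, Polynomial.eval_mul, Polynomial.eval_C]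
    ring

lemma sum_slice_eq_zero {n d : ℕ} {A B : Finset (Fin n)} (h : A ⊆ B)
    {P : MvPolynomial (Fin n) ℝ} (hP : P.totalDegree ≤ d) {F : Finset ℕ}
    (hF : ∀ t ∈ F, A.card ≤ t ∧ t ≤ B.card) (hcard : d + 1 ≤ F.card)
    (hv : ∀ C : Finset (Fin n), C.card ∈ F → eval (toR (indicatorVec C)) P = 0) (k : ℕ) :
    ∑ C ∈ slice A B (A.card + k), eval (toR (indicatorVec C)) P = 0 := by
  obtain ⟨q, hq, hqe⟩ := exists_polynomial_sum_slice h P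
  suffices hq0 : q = 0 by rw [hqe, hq0, Polynomial.eval_zero, mul_zero]
  have hinj : Set.InjOn (fun t : ℕ => ((t - A.card : ℕ) : ℝ)) F := by
    intro s hs t ht hst
    have h1 := (hF s hs).1
    have h2 := (hF t ht).1
    have h3 : s - A.card = t - A.card := Nat.cast_injective hst
    omega
  refine Polynomial.eq_zero_of_natDegree_lt_card_of_eval_eq_zero' q
    (F.image fun t : ℕ => ((t - A.card : ℕ) : ℝ)) ?_ ?_
  · intro y hy
    obtain ⟨t, ht, rfl⟩ := Finset.mem_image.mp hy
    obtain ⟨h1, h2⟩ := hF t ht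
    have h0 := hqe (t - A.card)
    rw [Finset.sum_eq_zero] at h0
    · have hc : ((B.card - A.card).choose (t - A.card) : ℝ) ≠ 0 := by
        exact_mod_cast (Nat.choose_pos (by omega)).ne'
      exact (mul_eq_zero.mp h0.symm).resolve_left hc
    · intro C hC
      refine hv C ?_
      rw [(Finset.mem_filter.mp hC).2, Nat.add_sub_cancel' h1]
      exact ht
  · rw [Finset.card_image_of_injOn hinj]
    omega

lemma slice_card_left {α : Type*} [DecidableEq α] {A B : Finset α} (h : A ⊆ B) :
    slice A B A.card = {A} := by
  ext C
  simp only [slice, Finset.mem_filter, Finset.mem_Icc, Finset.mem_singleton]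
  constructor
  · rintro ⟨⟨h1, -⟩, h2⟩
    exact (Finset.eq_of_subset_of_card_le h1 h2.le).symm
  · rintro rfl
    exact ⟨⟨le_rfl, h⟩, rfl⟩

lemma slice_card_right {α : Type*} [DecidableEq α] {A B : Finset α} (h : A ⊆ B) :
    slice A B B.card = {B} := by
  ext C
  simp only [slice, Finset.mem_filter, Finset.mem_Icc, Finset.mem_singleton]
  constructor
  · rintro ⟨⟨-, h1⟩, h2⟩
    exact Finset.eq_of_subset_of_card_le h1 h2.ge
  · rintro rfl
    exact ⟨⟨h, le_rfl⟩, rfl⟩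

/-- A polynomial of degree at most `d` that vanishes on the layers of `E` also vanishes on the
layers of `L_{n,d}(E)`. -/
lemma eval_eq_zero_of_card_mem_Lop {n d : ℕ} {E : Finset ℕ} (hE : E ⊆ Finset.range (n + 1))
    {P : MvPolynomial (Fin n) ℝ} (hP : P.totalDegree ≤ d)
    (hv : ∀ C : Finset (Fin n), C.card ∈ E → eval (toR (indicatorVec C)) P = 0)
    {A : Finset (Fin n)} (hA : A.card ∈ Lop n d E) : eval (toR (indicatorVec A)) P = 0 := by
  simp only [Lop, Finset.mem_union, Finset.mem_filter] at hA
  rcases hA with hA | ⟨-, hA | hA⟩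
  · exact hv A hA
  · have := sum_slice_eq_zero (Finset.subset_univ A) hP (F := E.filter fun t => A.card ≤ t)
      (fun t ht => by
        rw [Finset.mem_filter] at ht
        have := Finset.mem_range.mp (hE ht.1)
        exact ⟨ht.2, by simp only [Finset.card_univ, Fintype.card_fin]; omega⟩) hA
      (fun C hC => hv C (Finset.mem_filter.mp hC).1) 0
    rwa [add_zero, slice_card_left (Finset.subset_univ A), Finset.sum_singleton] at this
  · have := sum_slice_eq_zero (Finset.empty_subset A) hP (F := E.filter fun t => t ≤ A.card)
      (fun t ht => by simpa using (Finset.mem_filter.mp ht).2) hA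
      (fun C hC => hv C (Finset.mem_filter.mp hC).1) A.card
    rwa [Finset.card_empty, zero_add, slice_card_right (Finset.empty_subset A),
      Finset.sum_singleton] at this

lemma subset_Lop (N d : ℕ) (E : Finset ℕ) : E ⊆ Lop N d E := Finset.subset_union_left

lemma Lop_subset_range {N d : ℕ} {E : Finset ℕ} (hE : E ⊆ Finset.range (N + 1)) :
    Lop N d E ⊆ Finset.range (N + 1) :=
  Finset.union_subset hE (Finset.filter_subset _ _)

lemma iterate_Lop_subset_range {N d : ℕ} {E : Finset ℕ} (hE : E ⊆ Finset.range (N + 1)) (m : ℕ) :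
    (Lop N d)^[m] E ⊆ Finset.range (N + 1) := by
  induction m with
  | zero => exact hE
  | succ m ih => rw [Function.iterate_succ_apply']; exact Lop_subset_range ih

lemma subset_iterate_Lop (N d : ℕ) (E : Finset ℕ) (m : ℕ) : E ⊆ (Lop N d)^[m] E := by
  induction m with
  | zero => exact le_rfl
  | succ m ih => rw [Function.iterate_succ_apply']; exact ih.trans (subset_Lop _ _ _)

lemma exists_iterate_Lop_fixed {N d : ℕ} {E : Finset ℕ} (hE : E ⊆ Finset.range (N + 1)) :
    ∃ m, Lop N d ((Lop N d)^[m] E) = (Lop N d)^[m] E := by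
  by_contra! h
  have hlt : ∀ m, m ≤ ((Lop N d)^[m] E).card := by
    intro m
    induction m with
    | zero => exact Nat.zero_le _
    | succ m ih =>
      rw [Function.iterate_succ_apply']
      exact ih.trans_lt (Finset.card_lt_card ((subset_Lop _ _ _).ssubset_of_ne (h m).symm))
  have h1 := hlt (N + 2)
  have h2 := Finset.card_le_card (iterate_Lop_subset_range (d := d) hE (N + 2))
  rw [Finset.card_range] at h2
  omega

lemma eval_eq_zero_of_card_mem_iterate_Lop {n d : ℕ} {E : Finset ℕ}
    (hE : E ⊆ Finset.range (n + 1)) {P : MvPolynomial (Fin n) ℝ} (hP : P.totalDegree ≤ d)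
    (hv : ∀ C : Finset (Fin n), C.card ∈ E → eval (toR (indicatorVec C)) P = 0) (m : ℕ) :
    ∀ A : Finset (Fin n), A.card ∈ (Lop n d)^[m] E → eval (toR (indicatorVec A)) P = 0 := by
  induction m with
  | zero => exact hv
  | succ m ih =>
    intro A hA
    rw [Function.iterate_succ_apply'] at hA
    exact eval_eq_zero_of_card_mem_Lop (iterate_Lop_subset_range hE m) hP ih hA

/-- A weight `j` outside a set `F` fixed by `L_{N,d}` is in the middle: the excess
`i = |F| - d` is at most `min j (N - j)`, and `F` contains `T_{N,i}`. -/
lemma T_subset_of_Lop_fixed {N d j : ℕ} {F : Finset ℕ} (hF : F ⊆ Finset.range (N + 1))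
    (hfix : Lop N d F = F) (hj : j ≤ N) (hjF : j ∉ F) :
    T N (F.card - d) ⊆ F ∧ F.card - d ≤ j ∧ F.card - d + j ≤ N := by
  have key : ∀ m ≤ N, m ∉ F →
      (F.filter fun t => m ≤ t).card ≤ d ∧ (F.filter fun t => t ≤ m).card ≤ d := by
    intro m hm hmF
    rw [← hfix] at hmF
    simp only [Lop, Finset.mem_union, Finset.mem_filter, Finset.mem_range, not_or, not_and] at hmF
    have := hmF.2 (by omega)
    omega
  have hlow : ∀ m ≤ N, m ∉ F → F.card - d ≤ m := by
    intro m hm hmF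
    have h1 := (key m hm hmF).1
    have h2 := Finset.card_filter_add_card_filter_not (s := F) (fun t => m ≤ t)
    have h3 : (F.filter fun t => ¬ m ≤ t).card ≤ (Finset.range m).card :=
      Finset.card_le_card fun t ht => by
        rw [Finset.mem_filter] at ht
        exact Finset.mem_range.mpr (by omega)
    rw [Finset.card_range] at h3
    omega
  have hhigh : ∀ m ≤ N, m ∉ F → F.card - d + m ≤ N := by
    intro m hm hmF
    have h1 := (key m hm hmF).2
    have h2 := Finset.card_filter_add_card_filter_not (s := F) (fun t => t ≤ m)
    have h3 : (F.filter fun t => ¬ t ≤ m).card ≤ (Finset.Ioc m N).card :=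
      Finset.card_le_card fun t ht => by
        rw [Finset.mem_filter] at ht
        have := Finset.mem_range.mp (hF ht.1)
        exact Finset.mem_Ioc.mpr (by omega)
    rw [Nat.card_Ioc] at h3
    omega
  have hl := hlow j hj hjF
  have hh := hhigh j hj hjF
  refine ⟨fun m hm => ?_, hl, hh⟩
  simp only [T, Finset.mem_union, Finset.mem_range, Finset.mem_Icc] at hm
  by_contra hmF
  have hmN : m ≤ N := by omega
  have h1 := hlow m hmN hmF
  have h2 := hhigh m hmN hmF
  omega

lemma card_T {N i : ℕ} (h : 2 * i ≤ N) : (T N i).card = 2 * i := by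
  rw [T, Finset.card_union_of_disjoint, Finset.card_range, Nat.card_Icc]
  · omega
  · rw [Finset.disjoint_left]
    intro t ht ht'
    rw [Finset.mem_range] at ht
    rw [Finset.mem_Icc] at ht'
    omega

lemma prodLinear_prod {n : ℕ} {ι : Type*} [Fintype ι] (ℓ : ι → MvPolynomial (Fin n) ℝ)
    (h : ∀ t, (ℓ t).totalDegree ≤ 1) : ProdLinear n (∏ t, ℓ t) :=
  ⟨Fintype.card ι, fun t => ℓ ((Fintype.equivFin ι).symm t), fun _ => h _,
    (Equiv.prod_comp (Fintype.equivFin ι).symm ℓ).symm⟩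

lemma totalDegree_prod_le_card {n : ℕ} {ι : Type*} [Fintype ι] (ℓ : ι → MvPolynomial (Fin n) ℝ)
    (h : ∀ t, (ℓ t).totalDegree ≤ 1) : (∏ t, ℓ t).totalDegree ≤ Fintype.card ι := by
  refine (totalDegree_finsetProd _ _).trans ((Finset.sum_le_sum fun t _ => h t).trans ?_)
  simp

/-- If a set separates the two points of each of `i` disjoint pairs, then its size is between `i`
and `n - i`. -/
lemma card_bounds_of_separates {n i : ℕ} {p q : Fin i → Fin n}
    (hpq : Function.Injective (Sum.elim p q)) {C : Finset (Fin n)}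
    (hC : ∀ l, ¬ (p l ∈ C ↔ q l ∈ C)) : i ≤ C.card ∧ C.card + i ≤ n := by
  have key : ∀ D : Finset (Fin n), (∀ l, ¬ (p l ∈ D ↔ q l ∈ D)) → i ≤ D.card := by
    intro D hD
    have hinj : Function.Injective fun l => if p l ∈ D then p l else q l := by
      intro a b hab
      have hp : ∀ a b, p a = p b → a = b := fun a b h => by
        simpa using @hpq (Sum.inl a) (Sum.inl b) h
      have hq : ∀ a b, q a = q b → a = b := fun a b h => by
        simpa using @hpq (Sum.inr a) (Sum.inr b) h
      have hne : ∀ a b, p a ≠ q b := fun a b h => by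
        simpa using @hpq (Sum.inl a) (Sum.inr b) h
      dsimp only at hab
      split_ifs at hab
      · exact hp _ _ hab
      · exact absurd hab (hne _ _)
      · exact absurd hab.symm (hne _ _)
      · exact hq _ _ hab
    have := Finset.card_le_card_of_injOn (s := Finset.univ) (t := D) _
      (fun l _ => by
        have := hD l
        split_ifs with h
        · exact h
        · exact by_contra fun h' => this (by tauto)) hinj.injOn
    simpa using this
  have h1 := key C hC
  have h2 := key Cᶜ (fun l => by simpa [not_iff_not] using hC l)
  have h3 := Finset.card_add_card_compl C
  rw [Fintype.card_fin] at h3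
  omega

/-- A point whose weight lies outside a set `F` fixed by `L_{n,d}` is separated from `F̲` by a
product of at most `d` polynomials of degree at most one. -/
lemma exists_prodLinear_separating {n d : ℕ} {F : Finset ℕ} (hF : F ⊆ Finset.range (n + 1))
    (hfix : Lop n d F = F) {A : Finset (Fin n)} (hA : A.card ∉ F) :
    ∃ P : MvPolynomial (Fin n) ℝ, ProdLinear n P ∧ P.totalDegree ≤ d ∧
      (∀ C : Finset (Fin n), C.card ∈ F → eval (toR (indicatorVec C)) P = 0) ∧
      eval (toR (indicatorVec A)) P ≠ 0 := by
  have hAn : A.card ≤ n := by simpa using Finset.card_le_univ A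
  obtain ⟨hT, hi, hi'⟩ := T_subset_of_Lop_fixed hF hfix hAn hA
  set i := F.card - d with hidef
  obtain ⟨A₁, hA₁, hA₁c⟩ := Finset.exists_subset_card_eq hi
  have hcompl := Finset.card_add_card_compl A
  rw [Fintype.card_fin] at hcompl
  obtain ⟨A₀, hA₀, hA₀c⟩ := Finset.exists_subset_card_eq (s := Aᶜ) (n := i) (by omega)
  set p : Fin i → Fin n := fun l => (A₁.equivFinOfCardEq hA₁c).symm l
  set q : Fin i → Fin n := fun l => (A₀.equivFinOfCardEq hA₀c).symm l
  have hpA : ∀ l, p l ∈ A := fun l => hA₁ ((A₁.equivFinOfCardEq hA₁c).symm l).2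
  have hqA : ∀ l, q l ∉ A := fun l =>
    Finset.mem_compl.mp (hA₀ ((A₀.equivFinOfCardEq hA₀c).symm l).2)
  have hpq : Function.Injective (Sum.elim p q) := by
    refine Function.Injective.sumElim ?_ ?_ fun a b h => hqA b (h ▸ hpA a)
    · exact Subtype.val_injective.comp (Equiv.injective _)
    · exact Subtype.val_injective.comp (Equiv.injective _)
  let ℓ : Fin i ⊕ {t // t ∈ F \ T n i} → MvPolynomial (Fin n) ℝ :=
    Sum.elim (fun l => X (p l) - X (q l)) (fun t => ∑ a, X a - C ((t : ℕ) : ℝ))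
  have hℓ : ∀ t, (ℓ t).totalDegree ≤ 1 := by
    rintro (l | t)
    · refine (totalDegree_sub _ _).trans ?_
      simp
    · refine (totalDegree_sub _ _).trans (max_le ?_ ((totalDegree_C _).trans_le zero_le_one))
      exact totalDegree_finsetSum_le fun a _ => (totalDegree_X a).le
  have hinl : ∀ (D : Finset (Fin n)) (l : Fin i),
      eval (toR (indicatorVec D)) (ℓ (Sum.inl l)) = 0 ↔ (p l ∈ D ↔ q l ∈ D) := by
    intro D l
    by_cases h1 : p l ∈ D <;> by_cases h2 : q l ∈ D <;> simp [ℓ, toR, indicatorVec, h1, h2]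
  have hinr : ∀ (D : Finset (Fin n)) (t : {t // t ∈ F \ T n i}),
      eval (toR (indicatorVec D)) (ℓ (Sum.inr t)) = 0 ↔ D.card = t := by
    intro D t
    have : ∑ a, (indicatorVec D a : ℝ) = D.card := by
      exact_mod_cast wt_indicatorVec D
    simp [ℓ, toR, this, sub_eq_zero]
  refine ⟨∏ t, ℓ t, prodLinear_prod ℓ hℓ, (totalDegree_prod_le_card ℓ hℓ).trans ?_, ?_, ?_⟩
  · rw [Fintype.card_sum, Fintype.card_fin, Fintype.card_coe, Finset.card_sdiff_of_subset hT,
      card_T (by omega)]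
    have := Finset.card_le_card hT
    rw [card_T (by omega)] at this
    omega
  · intro D hD
    rw [map_prod]
    by_cases hDT : D.card ∈ T n i
    · have : ∃ l, p l ∈ D ↔ q l ∈ D := by
        by_contra! h
        have := card_bounds_of_separates hpq (C := D) fun l => by have := h l; tauto
        simp only [T, Finset.mem_union, Finset.mem_range, Finset.mem_Icc] at hDT
        omega
      obtain ⟨l, hl⟩ := this
      exact Finset.prod_eq_zero (Finset.mem_univ (Sum.inl l)) ((hinl D l).mpr hl)
    · exact Finset.prod_eq_zero
        (Finset.mem_univ (Sum.inr ⟨D.card, Finset.mem_sdiff.mpr ⟨hD, hDT⟩⟩)) ((hinr D _).mpr rfl)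
  · rw [map_prod, Finset.prod_ne_zero_iff]
    rintro (l | t) -
    · rw [Ne, hinl]
      exact fun h => hqA l (h.mp (hpA l))
    · rw [Ne, hinr]
      exact fun h => hA (h ▸ (Finset.mem_sdiff.mp t.2).1)

/-- in the Boolean cube, `h-cl_{n,d}(E̲) = Z-cl_{n,d}(E̲)`, and both equal the
symmetric set with weights `L̄_{n,d}(E)`. -/
theorem stmt8 (n : ℕ) (hn : 1 ≤ n) (d : ℕ) (hd : d ≤ n) (E : Finset ℕ)
    (hE : E ⊆ Finset.range (n + 1)) :
    hcl n (fun _ => 2) d (wdSet n (fun _ => 2) E)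
      = Zcl n (fun _ => 2) d (wdSet n (fun _ => 2) E) ∧
    Zcl n (fun _ => 2) d (wdSet n (fun _ => 2) E)
      = {x ∈ gridSet n (fun _ => 2) | wt x ∈ Lbar n d E} := by
  have hLZ : {x ∈ gridSet n (fun _ => 2) | wt x ∈ Lbar n d E}
      ⊆ Zcl n (fun _ => 2) d (wdSet n (fun _ => 2) E) := by
    rintro a ⟨ha, haL⟩
    refine ⟨ha, fun P hP hv => ?_⟩
    obtain ⟨A, rfl⟩ := exists_eq_indicatorVec ha
    obtain ⟨m, hm⟩ := Set.mem_iUnion.mp haL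
    rw [wt_indicatorVec] at hm
    refine eval_eq_zero_of_card_mem_iterate_Lop hE hP (fun D hD => ?_) m A hm
    exact hv _ ⟨indicatorVec_mem_gridSet D, by rwa [wt_indicatorVec]⟩
  have hZh : Zcl n (fun _ => 2) d (wdSet n (fun _ => 2) E)
      ⊆ hcl n (fun _ => 2) d (wdSet n (fun _ => 2) E) :=
    fun a ha => ⟨ha.1, fun P _ hP hv => ha.2 P hP hv⟩
  have hhL : hcl n (fun _ => 2) d (wdSet n (fun _ => 2) E)
      ⊆ {x ∈ gridSet n (fun _ => 2) | wt x ∈ Lbar n d E} := by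
    rintro a ⟨ha, hcl⟩
    refine ⟨ha, by_contra fun haL => ?_⟩
    obtain ⟨A, rfl⟩ := exists_eq_indicatorVec ha
    obtain ⟨m, hm⟩ := exists_iterate_Lop_fixed (d := d) hE
    have hA : A.card ∉ (Lop n d)^[m] E := fun h =>
      haL (Set.mem_iUnion.mpr ⟨m, by rwa [wt_indicatorVec]⟩)
    obtain ⟨P, hlin, hdeg, hv, hne⟩ :=
      exists_prodLinear_separating (iterate_Lop_subset_range hE m) hm hA
    refine hne (hcl P hlin hdeg fun x hx => ?_)
    obtain ⟨D, rfl⟩ := exists_eq_indicatorVec hx.1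
    refine hv D (subset_iterate_Lop n d E m ?_)
    have := hx.2
    rwa [wt_indicatorVec] at this
  exact ⟨(hhL.trans hLZ).antisymm hZh, (hZh.trans hhL).antisymm hLZ⟩

end CoveringSymmetric
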